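/- For every real x > 0, the function h(x) = e^{1/x} − ψ'(x) has the integral representation h(x) = 1 + ∫_0^∞ [∑_{m=0}^∞ u^m/(m!·(m+1)!) − u/(1 − e^{−u})] e^{−xu} du. -/

import Mathlib

open MeasureTheory

/-- The trigamma function `ψ'(t) = ∑_{n=0}^∞ 1/(t+n)²`. -/
noncomputable def trigamma (t : ℝ) : ℝ := ∑' n : ℕ, 1 / (t + n) ^ 2

theorem integral_pow_mul_exp_neg_mul_Ioi (n : ℕ) {r : ℝ} (hr : 0 < r) :
    ∫ u in Set.Ioi (0 : ℝ), u ^ n * Real.exp (-r * u) = n.factorial / r ^ (n + 1) := by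
  have h := Real.integral_rpow_mul_exp_neg_mul_Ioi (a := (n : ℝ) + 1) (by positivity) hr
  rw [Real.Gamma_nat_eq_factorial] at h
  simp only [add_sub_cancel_right, Real.rpow_natCast] at h
  simp only [neg_mul]
  rw [h, ← Nat.cast_succ, Real.rpow_natCast, one_div, inv_pow, div_eq_inv_mul]

theorem integrableOn_pow_mul_exp_neg_mul_Ioi (n : ℕ) {r : ℝ} (hr : 0 < r) :
    IntegrableOn (fun u : ℝ => u ^ n * Real.exp (-r * u)) (Set.Ioi 0) := by
  apply Integrable.of_integral_ne_zero
  rw [integral_pow_mul_exp_neg_mul_Ioi n hr]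
  positivity

/-- Termwise integration over a measurable set of a series of nonnegative integrable functions. -/
theorem setIntegral_eq_of_hasSum_of_nonneg {s : Set ℝ} (hs : MeasurableSet s)
    {F : ℕ → ℝ → ℝ} {G : ℝ → ℝ} {S : ℝ}
    (hF : ∀ n, IntegrableOn (F n) s) (hF0 : ∀ n, ∀ u ∈ s, 0 ≤ F n u)
    (hG : ∀ u ∈ s, HasSum (fun n => F n u) (G u))
    (hS : HasSum (fun n => ∫ u in s, F n u) S) :
    ∫ u in s, G u = S := by
  have hnorm : ∀ n, ∫ u in s, ‖F n u‖ = ∫ u in s, F n u := fun n =>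
    setIntegral_congr_fun hs fun u hu => Real.norm_of_nonneg (hF0 n u hu)
  have h := hasSum_integral_of_summable_integral_norm hF (by simpa only [hnorm] using hS.summable)
  rw [← h.unique hS]
  exact setIntegral_congr_fun hs fun u hu => (hG u hu).tsum_eq.symm

theorem summable_one_div_add_natCast_sq {x : ℝ} (hx : 0 < x) :
    Summable fun n : ℕ => 1 / (x + n) ^ 2 := by
  rw [← summable_nat_add_iff 1]
  refine Summable.of_nonneg_of_le (fun n => by positivity) (fun n => ?_)
    ((summable_nat_add_iff 1).2 (Real.summable_one_div_nat_pow.2 one_lt_two))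
  gcongr
  linarith

theorem trigamma_pos {x : ℝ} (hx : 0 < x) : 0 < trigamma x :=
  (summable_one_div_add_natCast_sq hx).tsum_pos (fun n => by positivity) 0 (by positivity)

theorem integral_div_one_sub_exp_neg_mul_exp {x : ℝ} (hx : 0 < x) :
    ∫ u in Set.Ioi (0 : ℝ), u / (1 - Real.exp (-u)) * Real.exp (-x * u) = trigamma x := by
  have hpos : ∀ n : ℕ, 0 < x + n := fun n => by positivity
  refine setIntegral_eq_of_hasSum_of_nonneg measurableSet_Ioi
    (F := fun n u => u ^ 1 * Real.exp (-(x + n) * u))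
    (fun n => integrableOn_pow_mul_exp_neg_mul_Ioi 1 (hpos n))
    (fun n u (hu : 0 < u) => by positivity) (fun u (hu : 0 < u) => ?_) ?_
  · have h := (hasSum_geometric_of_lt_one (Real.exp_pos (-u)).le
      (Real.exp_lt_one_iff.2 (neg_neg_of_pos hu))).mul_left (u * Real.exp (-x * u))
    convert! h using 1
    · ext n
      rw [← Real.exp_nat_mul, mul_assoc, ← Real.exp_add, pow_one]
      ring_nf
    · ring
  · simp only [fun n : ℕ => integral_pow_mul_exp_neg_mul_Ioi 1 (hpos n), Nat.factorial_one,
      Nat.cast_one]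
    exact (summable_one_div_add_natCast_sq hx).hasSum

theorem integral_tsum_pow_div_factorial_mul_exp {x : ℝ} (hx : 0 < x) :
    ∫ u in Set.Ioi (0 : ℝ), (∑' m : ℕ, u ^ m / (m.factorial * (m + 1).factorial)) *
      Real.exp (-x * u) = Real.exp (1 / x) - 1 := by
  refine setIntegral_eq_of_hasSum_of_nonneg measurableSet_Ioi
    (F := fun m u => 1 / (m.factorial * (m + 1).factorial) * (u ^ m * Real.exp (-x * u)))
    (fun m => (integrableOn_pow_mul_exp_neg_mul_Ioi m hx).const_mul _)
    (fun m u (hu : 0 < u) => by positivity) (fun u (hu : 0 < u) => ?_) ?_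
  · have hsum : Summable fun m : ℕ => u ^ m / (m.factorial * (m + 1).factorial : ℝ) := by
      refine Summable.of_nonneg_of_le (fun m => by positivity) (fun m => ?_)
        (Real.summable_pow_div_factorial u)
      gcongr
      exact le_mul_of_one_le_right (by positivity)
        (by exact_mod_cast Nat.succ_le_of_lt (Nat.factorial_pos _))
    convert! hsum.hasSum.mul_right (Real.exp (-x * u)) using 2 with m
    ring
  · have h : HasSum (fun n : ℕ => (1 / x) ^ n / n.factorial) (Real.exp (1 / x)) := by
      rw [Real.exp_eq_exp_ℝ]
      exact NormedSpace.expSeries_div_hasSum_exp (1 / x)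
    have h' := (hasSum_nat_add_iff' 1).2 h
    simp only [Finset.sum_range_one, pow_zero, Nat.factorial_zero, Nat.cast_one, div_one] at h'
    convert! h' using 2 with m
    rw [integral_const_mul, integral_pow_mul_exp_neg_mul_Ioi m hx]
    have := Nat.factorial_ne_zero m
    rw [one_div x, inv_pow]
    field_simp

/-- For every `x > 0`, the function `h(x) = e^{1/x} − ψ'(x)` satisfies
`h(x) = 1 + ∫_0^∞ [∑_{m=0}^∞ u^m/(m!·(m+1)!) − u/(1 − e^{−u})] e^{−xu} du`. -/
theorem exp_sub_trigamma_integral_repr (x : ℝ) (hx : 0 < x) :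
    Real.exp (1 / x) - trigamma x =
      1 + ∫ u in Set.Ioi (0 : ℝ),
        ((∑' m : ℕ, u ^ m / (m.factorial * (m + 1).factorial)) -
            u / (1 - Real.exp (-u))) *
          Real.exp (-x * u) := by
  have hA := integral_tsum_pow_div_factorial_mul_exp hx
  have hB := integral_div_one_sub_exp_neg_mul_exp hx
  have hexp : 1 < Real.exp (1 / x) := Real.one_lt_exp_iff.2 (by positivity)
  simp only [sub_mul]
  rw [integral_sub (.of_integral_ne_zero (hA ▸ (sub_pos.2 hexp).ne'))
    (.of_integral_ne_zero (hB ▸ (trigamma_pos hx).ne')), hA, hB]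
  ring
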